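/- arXiv:2208.05773 — 4 statements merged into one kernel-verified Lean document; each statement's English description precedes it below -/
import Mathlib

section
/- Let (R, P) be a commutative λ-TD algebra over a commutative ring k, and define a binary operation on R by x ∗ y = x·P(y) + P(x)·y + λ·x·y − x·P(1)·y. Then ∗ is associative (so (R, ∗) is a nonunitary associative k-algebra). -/
/-- The double product `x ∗ y = x·P(y) + P(x)·y + λ·x·y − x·P(1)·y` associated to a linear
operator `P` on a commutative `k`-algebra `R`. -/
def lambdaTDStar {k R : Type*} [CommRing k] [CommRing R] [Algebra k R]
    (lam : k) (P : R →ₗ[k] R) (x y : R) : R :=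
  x * P y + P x * y + lam • (x * y) - x * P 1 * y

/-- Let `(R, P)` be a commutative `λ`-TD algebra over a commutative ring `k`
and define `x ∗ y = x·P(y) + P(x)·y + λ·x·y − x·P(1)·y`.  Then `∗` is associative, so
`(R, ∗)` is a nonunitary associative `k`-algebra. -/
theorem lambdaTDStar_assoc
    {k R : Type*} [CommRing k] [CommRing R] [Algebra k R]
    (lam : k) (P : R →ₗ[k] R)
    (hP : ∀ x y : R, P x * P y = P (x * P y + P x * y + lam • (x * y) - x * P 1 * y)) :
    ∀ x y z : R,
      lambdaTDStar lam P (lambdaTDStar lam P x y) z =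
        lambdaTDStar lam P x (lambdaTDStar lam P y z) := by
  have map_star : ∀ x y : R, P (lambdaTDStar lam P x y) = P x * P y := fun x y => (hP x y).symm
  intro x y z
  rw [lambdaTDStar, map_star, lambdaTDStar.eq_def lam P x (lambdaTDStar lam P y z), map_star]
  simp only [lambdaTDStar, Algebra.smul_def]
  ring
end

section
/- Let (R, P) be a commutative λ-TD algebra over a commutative ring k, and define a binary operation on R by x ∗ y = x·P(y) + P(x)·y + λ·x·y − x·P(1)·y. Then (R, ∗, P) satisfies the λ-modified TD equation with respect to ∗: for all x, y ∈ R, P(x) ∗ P(y) = P(x ∗ P(y) + P(x) ∗ y + λ·(x ∗ y)) − x ∗ P(1) ∗ y. -/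
/-- Let `(R, P)` be a commutative `λ`-TD algebra over a commutative ring `k`,
and define `x ∗ y = x·P(y) + P(x)·y + λ·x·y − x·P(1)·y`.  Then `(R, ∗, P)` satisfies the
`λ`-modified TD equation with respect to `∗`:
`P(x) ∗ P(y) = P(x ∗ P(y) + P(x) ∗ y + λ·(x ∗ y)) − x ∗ P(1) ∗ y` for all `x, y ∈ R`. -/
theorem lambdaTDStar_modifiedTD
    {k R : Type*} [CommRing k] [CommRing R] [Algebra k R]
    (lam : k) (P : R →ₗ[k] R)
    (hP : ∀ x y : R, P x * P y = P (x * P y + P x * y + lam • (x * y) - x * P 1 * y)) :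
    ∀ x y : R,
      lambdaTDStar lam P (P x) (P y) =
        P (lambdaTDStar lam P x (P y) + lambdaTDStar lam P (P x) y
            + lam • lambdaTDStar lam P x y)
          - lambdaTDStar lam P (lambdaTDStar lam P x (P 1)) y := by
  intro x y
  have map_star (a b : R) : P (lambdaTDStar lam P a b) = P a * P b := (hP a b).symm
  have map_map (a : R) : P (P a) = P 1 * P a - lam • P a := by
    have h := hP a 1
    rw [show a * P 1 + P a * 1 + lam • (a * 1) - a * P 1 * 1 = P a + lam • a by
      simp only [mul_one]; abel, map_add, map_smul] at h
    rw [eq_sub_iff_add_eq, ← h, mul_comm]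
  have map_one_mul (a : R) : P (P 1 * P a) = P 1 * P (P a) := by
    have h : P 1 * P a = P (P a) + lam • P a := by rw [map_map]; abel
    rw [h, map_add, map_smul, map_map (P a)]
    abel
  have star_map_one : lambdaTDStar lam P x (P 1) = P 1 * P x := by
    simp only [lambdaTDStar, map_map, Algebra.smul_def]
    ring
  rw [star_map_one, map_add, map_add, map_smul, map_star, map_star, map_star]
  simp only [lambdaTDStar, map_one_mul, map_map, Algebra.smul_def]
  ring
end

section
/- Let A be a unital commutative k-algebra and let ⧢ denote the λ-TD shuffle product on Ш(A) = ⊕_{n≥0} A^{⊗n}. Then for all pure tensors 𝔞 ∈ A^{⊗m} and 𝔟 ∈ A^{⊗n} with m, n ≥ 1, one has (1_A ⊗ 𝔞) ⧢ 𝔟 = 𝔞 ⧢ (1_A ⊗ 𝔟) = 1_A ⊗ (𝔞 ⧢ 𝔟). -/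
/-!
Common setup: the `λ`-TD shuffle product on `Ш(A) = ⊕_{n ≥ 0} A^{⊗n}` over a commutative
ring `k`, where `A` is a unital commutative `k`-algebra and `A^{⊗0} = k`.  Pure tensors of
positive length are written `Fin.cons a f`, the operation "prepend `a`", i.e. `a ⊗ (–)`,
is implemented as multiplication by the degree-one element `shIota k A a` in the graded
(concatenation) algebra `⊕_{n ≥ 0} A^{⊗n}`.
-/

open scoped TensorProduct DirectSum
open PiTensorProduct

noncomputable section

variable (k A : Type*) [CommRing k] [CommRing A] [Algebra k A]

/-- The shuffle module `Ш(A) = ⊕_{n ≥ 0} A^{⊗n}` (with `A^{⊗0} = k`). -/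
abbrev ShuffleModule : Type _ := ⨁ n : ℕ, ⨂[k]^n A

/-- The pure tensor `a₁ ⊗ ⋯ ⊗ aₙ ∈ A^{⊗n} ⊆ Ш(A)`. -/
def shEmb {n : ℕ} (f : Fin n → A) : ShuffleModule k A :=
  DirectSum.lof k ℕ (fun n => ⨂[k]^n A) n (tprod k f)

/-- The inclusion of `A^{⊗0} = k` into `Ш(A)`. -/
def shDeg0 (v : ⨂[k]^0 A) : ShuffleModule k A :=
  DirectSum.lof k ℕ (fun n => ⨂[k]^n A) 0 v

/-- Length-one pure tensors, as a linear map `A →ₗ[k] Ш(A)`. -/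
def shIota : A →ₗ[k] ShuffleModule k A :=
  (DirectSum.lof k ℕ (fun n => ⨂[k]^n A) 1).comp
    ((MultilinearMap.ofSubsingleton k A (⨂[k]^1 A) (0 : Fin 1)).symm (tprod k))

/-- The element `1_A ∈ A ⊆ Ш(A)`. -/
def shOneA : ShuffleModule k A := shIota k A (1 : A)

variable (lam : k)

/-- `sh` is the `λ`-TD shuffle product on `Ш(A) = ⊕_{n≥0} A^{⊗n}`: it is `k`-bilinear, acts
by scalar multiplication when one of the arguments lies in `A^{⊗0} = k`, and for pure tensors
`𝔞 = a₁ ⊗ 𝔞'`, `𝔟 = b₁ ⊗ 𝔟'` of positive lengths it satisfies the recursion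
`𝔞 ⧢ 𝔟 = a₁ ⊗ (𝔞' ⧢ 𝔟) + b₁ ⊗ (𝔞 ⧢ 𝔟') + λ·a₁b₁ ⊗ (𝔞' ⧢ 𝔟') − a₁b₁ ⊗ ((𝔞' ⧢ 1_A) ⧢ 𝔟')`. -/
structure IsLambdaTDShuffle
    (sh : ShuffleModule k A →ₗ[k] ShuffleModule k A →ₗ[k] ShuffleModule k A) : Prop where
  scalar_left : ∀ (v : ⨂[k]^0 A) (x : ShuffleModule k A),
    sh (shDeg0 k A v) x = (isEmptyEquiv (Fin 0) v) • x
  scalar_right : ∀ (v : ⨂[k]^0 A) (x : ShuffleModule k A),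
    sh x (shDeg0 k A v) = (isEmptyEquiv (Fin 0) v) • x
  shuffle_rec : ∀ {m n : ℕ} (a b : A) (f : Fin m → A) (g : Fin n → A),
    sh (shEmb k A (Fin.cons a f)) (shEmb k A (Fin.cons b g)) =
      shIota k A a * sh (shEmb k A f) (shEmb k A (Fin.cons b g))
      + shIota k A b * sh (shEmb k A (Fin.cons a f)) (shEmb k A g)
      + lam • (shIota k A (a * b) * sh (shEmb k A f) (shEmb k A g))
      - shIota k A (a * b) * sh (sh (shEmb k A f) (shOneA k A)) (shEmb k A g)

end

noncomputable section
variable {k A : Type*} [CommRing k] [CommRing A] [Algebra k A] {lam : k}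

theorem shIota_eq_shEmb (a : A) : shIota k A a = shEmb k A (fun _ : Fin 1 => a) := rfl

theorem shIota_mul_shEmb (a : A) {n : ℕ} (f : Fin n → A) :
    shIota k A a * shEmb k A f = shEmb k A (Fin.cons a f : Fin (n + 1) → A) := by
  rw [shIota_eq_shEmb, shEmb, shEmb, shEmb, DirectSum.lof_eq_of, DirectSum.lof_eq_of,
    DirectSum.lof_eq_of, DirectSum.of_mul_of]
  refine DirectSum.of_eq_of_gradedMonoid_eq
    (TensorPower.gradedMonoid_eq_of_cast (Nat.add_comm 1 n) ?_)
  refine (congrArg (TensorPower.cast k A (Nat.add_comm 1 n))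
    (TensorPower.tprod_mul_tprod k (fun _ : Fin 1 => a) f)).trans ?_
  rw [TensorPower.cast_tprod, Fin.append_left_eq_cons]
  rfl

theorem shOneA_mul_shEmb {n : ℕ} (f : Fin n → A) :
    shOneA k A * shEmb k A f = shEmb k A (Fin.cons (1 : A) f : Fin (n + 1) → A) :=
  shIota_mul_shEmb 1 f

theorem shOneA_eq_shEmb (e : Fin 0 → A) :
    shOneA k A = shEmb k A (Fin.cons (1 : A) e : Fin 1 → A) := by
  rw [shOneA, shIota_eq_shEmb]
  congr 1
  funext i
  rw [Subsingleton.elim i 0, Fin.cons_zero]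

namespace IsLambdaTDShuffle

variable {sh : ShuffleModule k A →ₗ[k] ShuffleModule k A →ₗ[k] ShuffleModule k A}

theorem empty_left (hsh : IsLambdaTDShuffle k A lam sh) (e : Fin 0 → A) (x : ShuffleModule k A) :
    sh (shEmb k A e) x = x := by
  have h := hsh.scalar_left (tprod k e) x
  rwa [isEmptyEquiv_apply_tprod, one_smul] at h

theorem empty_right (hsh : IsLambdaTDShuffle k A lam sh) (e : Fin 0 → A) (x : ShuffleModule k A) :
    sh x (shEmb k A e) = x := by
  have h := hsh.scalar_right (tprod k e) x
  rwa [isEmptyEquiv_apply_tprod, one_smul] at h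

/-- Left shuffling with `1_A`. -/
theorem one_left (hsh : IsLambdaTDShuffle k A lam sh) {n : ℕ} (g : Fin (n + 1) → A) :
    sh (shOneA k A) (shEmb k A g) = shOneA k A * shEmb k A g + lam • shEmb k A g := by
  obtain ⟨b, g, rfl⟩ : ∃ b g', g = Fin.cons b g' := ⟨_, _, (Fin.cons_self_tail g).symm⟩
  have h := hsh.shuffle_rec 1 b (Fin.elim0 : Fin 0 → A) g
  rw [← shOneA_eq_shEmb] at h
  simp only [hsh.empty_left, _root_.one_mul, shIota_mul_shEmb] at h
  rw [h, shOneA]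
  simp only [shIota_mul_shEmb]
  abel

/-- Right shuffling with `1_A`. -/
theorem one_right (hsh : IsLambdaTDShuffle k A lam sh) {m : ℕ} (f : Fin (m + 1) → A) :
    sh (shEmb k A f) (shOneA k A) = shOneA k A * shEmb k A f + lam • shEmb k A f := by
  obtain ⟨a, f, rfl⟩ : ∃ a f', f = Fin.cons a f' := ⟨_, _, (Fin.cons_self_tail f).symm⟩
  have h := hsh.shuffle_rec a 1 f (Fin.elim0 : Fin 0 → A)
  rw [← shOneA_eq_shEmb] at h
  simp only [hsh.empty_right, _root_.mul_one, shIota_mul_shEmb] at h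
  rw [h, shOneA]
  simp only [shIota_mul_shEmb]
  abel

theorem cons_one_left (hsh : IsLambdaTDShuffle k A lam sh) {m n : ℕ}
    (f : Fin (m + 1) → A) (g : Fin (n + 1) → A) :
    sh (shEmb k A (Fin.cons (1 : A) f)) (shEmb k A g) =
      shOneA k A * sh (shEmb k A f) (shEmb k A g) := by
  obtain ⟨b, g, rfl⟩ : ∃ b g', g = Fin.cons b g' := ⟨_, _, (Fin.cons_self_tail g).symm⟩
  rw [hsh.shuffle_rec, hsh.one_right, shOneA_mul_shEmb, map_add, map_smul,
    LinearMap.add_apply, LinearMap.smul_apply, mul_add, mul_smul_comm, _root_.one_mul, shOneA]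
  abel

theorem cons_one_right (hsh : IsLambdaTDShuffle k A lam sh) {m n : ℕ}
    (f : Fin (m + 1) → A) (g : Fin (n + 1) → A) :
    sh (shEmb k A f) (shEmb k A (Fin.cons (1 : A) g)) =
      shOneA k A * sh (shEmb k A f) (shEmb k A g) := by
  induction m with
  | zero =>
    obtain ⟨a, f, rfl⟩ : ∃ a f', f = Fin.cons a f' := ⟨_, _, (Fin.cons_self_tail f).symm⟩
    rw [hsh.shuffle_rec, hsh.empty_left, hsh.empty_left, hsh.empty_left, hsh.one_left,
      shOneA_mul_shEmb, mul_add, mul_smul_comm, _root_.mul_one, shOneA]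
    abel
  | succ m ih =>
    obtain ⟨a, f, rfl⟩ : ∃ a f', f = Fin.cons a f' := ⟨_, _, (Fin.cons_self_tail f).symm⟩
    rw [hsh.shuffle_rec, ih, hsh.one_right, shOneA_mul_shEmb, map_add, map_smul,
      LinearMap.add_apply, LinearMap.smul_apply, hsh.cons_one_left, mul_add, mul_smul_comm,
      _root_.mul_one, shOneA]
    abel

end IsLambdaTDShuffle

/-- For the `λ`-TD shuffle product `⧢` on `Ш(A)` and all pure tensors
`𝔞 ∈ A^{⊗m}`, `𝔟 ∈ A^{⊗n}` with `m, n ≥ 1`, one has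
`(1_A ⊗ 𝔞) ⧢ 𝔟 = 𝔞 ⧢ (1_A ⊗ 𝔟) = 1_A ⊗ (𝔞 ⧢ 𝔟)`. -/
theorem lambdaTDShuffle_cons_one
    (sh : ShuffleModule k A →ₗ[k] ShuffleModule k A →ₗ[k] ShuffleModule k A)
    (hsh : IsLambdaTDShuffle k A lam sh) :
    ∀ {m n : ℕ} (f : Fin (m + 1) → A) (g : Fin (n + 1) → A),
      sh (shEmb k A (Fin.cons (1 : A) f)) (shEmb k A g) =
        sh (shEmb k A f) (shEmb k A (Fin.cons (1 : A) g)) ∧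
      sh (shEmb k A (Fin.cons (1 : A) f)) (shEmb k A g) =
        shOneA k A * sh (shEmb k A f) (shEmb k A g) := by
  intro m n f g
  exact ⟨(hsh.cons_one_left f g).trans (hsh.cons_one_right f g).symm, hsh.cons_one_left f g⟩

end
end

section
/- Let k be a field and H a connected filtered left counital operated bialgebra over k. Then H is a left counital Hopf algebra: the linear map S : H → H defined recursively on H = k·1_H ⊕ ker ε by S(1_H) = 1_H and S(x) = −Σ x′ S(x″) for x ∈ ker ε (where Δ(x) = 1 ⊗ x + Σ x′ ⊗ x″ with Σ x′ ⊗ x″ ∈ ker ε ⊗ H⁰ + ker ε ⊗ ker ε) is a right antipode, i.e., m ∘ (id ⊗ S) ∘ Δ = μ ∘ ε. -/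
open scoped TensorProduct

namespace LeftCounital

/-- A self-map of a space of linear maps which improves agreement along an exhaustive filtration
has a fixed point. -/
theorem exists_fixedPoint_of_contracting {k M N : Type*} [Semiring k] [AddCommMonoid M]
    [AddCommMonoid N] [Module k M] [Module k N] {F : ℕ → Submodule k M} (hmono : Monotone F)
    (hunion : ∀ x : M, ∃ n, x ∈ F n) (Φ : (M →ₗ[k] N) → (M →ₗ[k] N))
    (hΦ : ∀ (n : ℕ) (f g : M →ₗ[k] N),
      (∀ m < n, ∀ x ∈ F m, f x = g x) → ∀ x ∈ F n, Φ f x = Φ g x) :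
    ∃ f : M →ₗ[k] N, Φ f = f := by
  let s : ℕ → M →ₗ[k] N := fun n => Φ^[n] 0
  have hs : ∀ n, s (n + 1) = Φ (s n) := fun n => Function.iterate_succ_apply' Φ n 0
  have hstep : ∀ n m, m < n → ∀ x ∈ F m, s (n + 1) x = s n x := by
    intro n
    induction n with
    | zero => intro m hm; omega
    | succ n ih =>
      intro m hm x hx
      rw [hs (n + 1)]
      nth_rewrite 2 [hs n]
      exact hΦ m _ _ (fun l hl => ih l (by omega)) x hx
  have hstable : ∀ m n, m < n → ∀ x ∈ F m, s n x = s (m + 1) x := by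
    intro m n hmn
    induction n, hmn using Nat.le_induction with
    | base => intro x _; rfl
    | succ n hn ih => intro x hx; rw [hstep n m hn x hx, ih x hx]
  choose r hr using hunion
  have hlim : ∀ x n, x ∈ F n → s (r x + 1) x = s (n + 1) x := by
    intro x n hx
    rw [← hstable (r x) (max (r x) n + 1) (by omega) x (hr x),
      hstable n (max (r x) n + 1) (by omega) x hx]
  let f : M →ₗ[k] N :=
    { toFun := fun x => s (r x + 1) x
      map_add' := fun x y => by
        have hx : x ∈ F (max (r x) (r y)) := hmono (le_max_left _ _) (hr x)
        have hy : y ∈ F (max (r x) (r y)) := hmono (le_max_right _ _) (hr y)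
        rw [hlim _ _ hx, hlim _ _ hy, hlim _ _ (add_mem hx hy), map_add]
      map_smul' := fun c x => by
        rw [hlim _ _ (Submodule.smul_mem _ c (hr x)), map_smul, RingHom.id_apply] }
  refine ⟨f, LinearMap.ext fun x => ?_⟩
  change Φ f x = s (r x + 1) x
  rw [hs]
  refine hΦ (r x) f (s (r x)) (fun m hm y hy => ?_) x (hr x)
  change s (r y + 1) y = _
  rw [hlim y m hy, hstable m (r x) hm y hy]

theorem lTensor_congr_of_mem_map₂ {k L M N : Type*} [CommSemiring k] [AddCommMonoid L]
    [AddCommMonoid M] [AddCommMonoid N] [Module k L] [Module k M] [Module k N]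
    {A : Submodule k L} {B : Submodule k M} {f g : M →ₗ[k] N} (h : ∀ x ∈ B, f x = g x)
    {t : L ⊗[k] M} (ht : t ∈ Submodule.map₂ (TensorProduct.mk k L M) A B) :
    LinearMap.lTensor L f t = LinearMap.lTensor L g t := by
  have hle : Submodule.map₂ (TensorProduct.mk k L M) A B ≤
      LinearMap.eqLocus (LinearMap.lTensor L f) (LinearMap.lTensor L g) :=
    Submodule.map₂_le.2 fun a _ b hb => by simp [LinearMap.mem_eqLocus, h b hb]
  exact hle ht

theorem lid_rTensor_mem_of_mem_map₂ {k L M : Type*} [CommSemiring k] [AddCommMonoid L]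
    [AddCommMonoid M] [Module k L] [Module k M] (ε : L →ₗ[k] k)
    {A : Submodule k L} {B : Submodule k M}
    {t : L ⊗[k] M} (ht : t ∈ Submodule.map₂ (TensorProduct.mk k L M) A B) :
    TensorProduct.lid k M (LinearMap.rTensor M ε t) ∈ B := by
  have hle : Submodule.map₂ (TensorProduct.mk k L M) A B ≤
      B.comap ((TensorProduct.lid k M).toLinearMap ∘ₗ LinearMap.rTensor M ε) :=
    Submodule.map₂_le.2 fun a _ b hb => by simpa using B.smul_mem (ε a) hb
  exact hle ht

/-- In a connected filtered left counital bialgebra, `Δ x - 1 ⊗ x` has its right tensor factors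
in a strictly smaller filtration step than `x`. -/
theorem comul_sub_one_tmul_mem {k H : Type*} [Field k] [Ring H] [Algebra k H]
    {Δ : H →ₗ[k] H ⊗[k] H} {ε : H →ₗ[k] k} (hε1 : ε 1 = 1)
    (hcounit : ∀ x : H, LinearMap.rTensor H ε (Δ x) = (1 : k) ⊗ₜ[k] x)
    {F : ℕ → Submodule k H} (hmono : Monotone F)
    (hfilΔ : ∀ n : ℕ, ∀ x ∈ F n,
      Δ x ∈ Submodule.map₂ (TensorProduct.mk k H H) (F 0) (F n) ⊔
        ⨆ (p : ℕ) (q : ℕ) (_ : p + q = n ∧ 0 < p ∧ 0 < q),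
          Submodule.map₂ (TensorProduct.mk k H H) (F p) (F q))
    (hconn : F 0 = LinearMap.range (Algebra.linearMap k H))
    {n : ℕ} {x : H} (hx : x ∈ F (n + 1)) :
    Δ x - 1 ⊗ₜ[k] x ∈ Submodule.map₂ (TensorProduct.mk k H H) ⊤ (F n) := by
  obtain ⟨u, hu, t, ht, hut⟩ := Submodule.mem_sup.1 (hfilΔ _ x hx)
  have ht' : t ∈ Submodule.map₂ (TensorProduct.mk k H H) ⊤ (F n) := by
    refine (iSup_le fun p => iSup_le fun q => iSup_le fun hpq => ?_ :
      _ ≤ Submodule.map₂ (TensorProduct.mk k H H) ⊤ (F n)) ht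
    exact Submodule.map₂_le_map₂ le_top (hmono (by omega))
  obtain ⟨y, rfl⟩ : ∃ y : H, (1 : H) ⊗ₜ[k] y = u := by
    have hle : Submodule.map₂ (TensorProduct.mk k H H) (F 0) (F (n + 1)) ≤
        LinearMap.range (TensorProduct.mk k H H 1) := by
      refine Submodule.map₂_le.2 fun a ha b _ => ?_
      rw [hconn] at ha
      obtain ⟨c, rfl⟩ := ha
      exact ⟨c • b, by simp [Algebra.algebraMap_eq_smul_one]⟩
    exact hle hu
  have hxy : x = y + TensorProduct.lid k H (LinearMap.rTensor H ε t) := by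
    have h := congrArg (TensorProduct.lid k H) (hcounit x)
    rw [← hut] at h
    simpa [hε1] using h.symm
  have hdiff : Δ x - 1 ⊗ₜ[k] x =
      t - 1 ⊗ₜ[k] TensorProduct.lid k H (LinearMap.rTensor H ε t) := by
    nth_rewrite 2 [hxy]
    rw [← hut, TensorProduct.tmul_add]
    abel
  rw [hdiff]
  exact sub_mem ht' (Submodule.apply_mem_map₂ (TensorProduct.mk k H H) Submodule.mem_top
    (lid_rTensor_mem_of_mem_map₂ ε ht'))

end LeftCounital

/-- Let `k` be a field and `H` a connected filtered left counital operated
bialgebra over `k` (with operator `P`, coassociative comultiplication `Δ` and left counital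
counit `ε`, both algebra homomorphisms, and an increasing filtration `F` with `⋃ₙ F n = H`,
`F p · F q ⊆ F (p+q)`, `Δ(F n) ⊆ F 0 ⊗ F n + Σ_{p+q=n, p,q>0} F p ⊗ F q` and
`F 0 = im μ = k·1`).  Then `H` is a left counital Hopf algebra: there is a `k`-linear map
`S : H → H` with `S(1) = 1` which is a right antipode, i.e.
`m ∘ (id ⊗ S) ∘ Δ = μ ∘ ε`. -/
theorem connected_filtered_leftCounital_bialgebra_isHopf
    {k H : Type*} [Field k] [Ring H] [Algebra k H]
    (P : H →ₗ[k] H)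
    (Δ : H →ₗ[k] H ⊗[k] H) (ε : H →ₗ[k] k)
    (hΔ1 : Δ 1 = 1 ⊗ₜ[k] 1) (hΔmul : ∀ x y : H, Δ (x * y) = Δ x * Δ y)
    (hε1 : ε 1 = 1) (hεmul : ∀ x y : H, ε (x * y) = ε x * ε y)
    (hcoassoc :
      (TensorProduct.assoc k H H H).toLinearMap.comp ((LinearMap.rTensor H Δ).comp Δ) =
        (LinearMap.lTensor H Δ).comp Δ)
    (hcounit : ∀ x : H, LinearMap.rTensor H ε (Δ x) = (1 : k) ⊗ₜ[k] x)
    (F : ℕ → Submodule k H)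
    (hmono : Monotone F)
    (hunion : ∀ x : H, ∃ n, x ∈ F n)
    (hfilmul : ∀ p q : ℕ, ∀ x ∈ F p, ∀ y ∈ F q, x * y ∈ F (p + q))
    (hfilΔ : ∀ n : ℕ, ∀ x ∈ F n,
      Δ x ∈ Submodule.map₂ (TensorProduct.mk k H H) (F 0) (F n) ⊔
        ⨆ (p : ℕ) (q : ℕ) (_ : p + q = n ∧ 0 < p ∧ 0 < q),
          Submodule.map₂ (TensorProduct.mk k H H) (F p) (F q))
    (hconn : F 0 = LinearMap.range (Algebra.linearMap k H)) :
    ∃ S : H →ₗ[k] H, S 1 = 1 ∧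
      ∀ x : H, LinearMap.mul' k H (LinearMap.lTensor H S (Δ x)) = algebraMap k H (ε x) := by
  have hzero : ∀ x ∈ F 0, Δ x - 1 ⊗ₜ[k] x = 0 := by
    intro x hx
    rw [hconn] at hx
    obtain ⟨c, rfl⟩ := hx
    simp [Algebra.algebraMap_eq_smul_one, hΔ1]
  let T : (H →ₗ[k] H) → (H →ₗ[k] H) := fun S =>
    LinearMap.mul' k H ∘ₗ LinearMap.lTensor H S ∘ₗ (Δ - TensorProduct.mk k H H 1)
  have hT : ∀ S x, T S x = LinearMap.mul' k H (LinearMap.lTensor H S (Δ x - 1 ⊗ₜ[k] x)) :=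
    fun S x => rfl
  obtain ⟨S, hS⟩ := LeftCounital.exists_fixedPoint_of_contracting hmono hunion
    (fun S => Algebra.linearMap k H ∘ₗ ε - T S) (by
      intro n f g hfg x hx
      simp only [LinearMap.sub_apply, hT]
      congr 2
      cases n with
      | zero => rw [hzero x hx, map_zero, map_zero]
      | succ n =>
        exact LeftCounital.lTensor_congr_of_mem_map₂ (hfg n n.lt_succ_self)
          (LeftCounital.comul_sub_one_tmul_mem hε1 hcounit hmono hfilΔ hconn hx))
  have hfix : ∀ x, algebraMap k H (ε x) - T S x = S x := fun x => LinearMap.congr_fun hS x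
  refine ⟨S, ?_, fun x => ?_⟩
  · rw [← hfix, hT, hΔ1, hε1]
    simp
  · have hx := hfix x
    rw [hT, map_sub, map_sub, LinearMap.lTensor_tmul, LinearMap.mul'_apply, one_mul] at hx
    rw [sub_sub_eq_add_sub, sub_eq_iff_eq_add, add_comm (S x)] at hx
    exact (add_right_cancel hx).symm
end
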